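/- arXiv:1812.02298 — 2 statements merged into one kernel-verified Lean document; each statement's English description precedes it below -/
import Mathlib

section
/- Law of Large Numbers for the general compound Hawkes process with two-state dependent orders (Corollary 'LLN for GCHP2SDO'): For every t ≥ 0, S_{nt}/n converges almost surely, as n → ∞, to (a₁π₁* + a₂π₂*)·c·t. -/
open MeasureTheory ProbabilityTheory Filter Finset Matrix Topology

/-- A process with bounded increments whose second moment grows at most linearly is almost
surely `o(n)`. -/
theorem ae_tendsto_div_of_integral_sq_le {Ω : Type*} [MeasurableSpace Ω] (μ : Measure Ω)
    (Y : ℕ → Ω → ℝ) (hYmeas : ∀ n, Measurable (Y n)) (B C : ℝ)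
    (hinc : ∀ n ω, |Y (n + 1) ω - Y n ω| ≤ B)
    (hint : ∀ n, Integrable (fun ω => Y n ω ^ 2) μ)
    (hsq : ∀ n : ℕ, ∫ ω, Y n ω ^ 2 ∂μ ≤ C * n) :
    ∀ᵐ ω ∂μ, Tendsto (fun n : ℕ => Y n ω / n) atTop (𝓝 0) := by
  have hsub : ∀ᵐ ω ∂μ, Tendsto (fun m : ℕ => Y (m ^ 2) ω / (m : ℝ) ^ 2) atTop (𝓝 0) := by
    have hfin : ∫⁻ ω, ∑' m : ℕ, ENNReal.ofReal ((Y (m ^ 2) ω / (m : ℝ) ^ 2) ^ 2) ∂μ ≠ ⊤ := by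
      rw [lintegral_tsum fun m => by fun_prop]
      have hsum : Summable fun m : ℕ => C * (1 / (m : ℝ) ^ 2) :=
        (Real.summable_one_div_nat_pow.mpr one_lt_two).mul_left C
      refine ne_top_of_le_ne_top hsum.tsum_ofReal_ne_top (ENNReal.tsum_le_tsum fun m => ?_)
      have hm : ∀ ω, (Y (m ^ 2) ω / (m : ℝ) ^ 2) ^ 2
          = Y (m ^ 2) ω ^ 2 * (1 / (m : ℝ) ^ 4) := fun ω => by
        rw [div_pow]; ring
      simp_rw [hm]
      rw [← ofReal_integral_eq_lintegral_ofReal ((hint _).mul_const _)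
        (ae_of_all _ fun ω => by positivity), integral_mul_const]
      refine ENNReal.ofReal_le_ofReal ?_
      rcases Nat.eq_zero_or_pos m with rfl | hmpos
      · simp
      have := hsq (m ^ 2)
      have hm0 : (m : ℝ) ≠ 0 := by positivity
      calc _ ≤ C * ((m ^ 2 : ℕ) : ℝ) * (1 / (m : ℝ) ^ 4) := by gcongr
        _ = _ := by push_cast; field_simp
    filter_upwards [ae_lt_top' (by fun_prop) hfin] with ω hω
    have h0 := ENNReal.tendsto_atTop_zero_of_tsum_ne_top hω.ne
    have h1 := (ENNReal.tendsto_toReal ENNReal.zero_ne_top).comp h0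
    have h2 : Tendsto (fun m : ℕ => (Y (m ^ 2) ω / (m : ℝ) ^ 2) ^ 2) atTop (𝓝 0) := by
      refine h1.congr fun m => ?_
      simp [ENNReal.toReal_ofReal (sq_nonneg _)]
    have h3 := h2.sqrt
    simp only [Real.sqrt_sq_eq_abs, Real.sqrt_zero] at h3
    exact (tendsto_zero_iff_abs_tendsto_zero _).mpr h3
  filter_upwards [hsub] with ω hω
  have hlip : ∀ n d : ℕ, |Y (n + d) ω - Y n ω| ≤ B * d := by
    intro n d
    induction d with
    | zero => simp
    | succ d ih =>
      have h := abs_add_le (Y (n + d + 1) ω - Y (n + d) ω) (Y (n + d) ω - Y n ω)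
      have h' := hinc (n + d) ω
      rw [sub_add_sub_cancel] at h
      rw [← add_assoc]
      push_cast
      linarith
  have hB : 0 ≤ B := (abs_nonneg _).trans (hinc 0 ω)
  have hsqrt : Tendsto Nat.sqrt atTop atTop :=
    tendsto_atTop_atTop.mpr fun b => ⟨b * b, fun n hn => Nat.le_sqrt.mpr hn⟩
  have hbound : Tendsto (fun m : ℕ => |Y (m ^ 2) ω / (m : ℝ) ^ 2| + 2 * B * (1 / (m : ℝ)))
      atTop (𝓝 0) := by
    simpa using hω.abs.add (tendsto_one_div_atTop_nhds_zero_nat.const_mul (2 * B))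
  refine squeeze_zero_norm' ?_ (hbound.comp hsqrt)
  filter_upwards [eventually_ge_atTop 1] with n hn
  obtain ⟨m, hm⟩ : ∃ m, m = Nat.sqrt n := ⟨_, rfl⟩
  have hm1 : 1 ≤ m := hm ▸ Nat.le_sqrt.mpr (by simpa using hn)
  have hmn : m ^ 2 ≤ n := by rw [hm, sq]; exact Nat.sqrt_le n
  have hnm : n ≤ m ^ 2 + 2 * m := by
    have := Nat.sqrt_le_add n
    rw [← hm] at this
    linarith
  obtain ⟨d, rfl⟩ := Nat.exists_eq_add_of_le hmn
  have hd : (d : ℝ) ≤ 2 * m := by exact_mod_cast (by omega : d ≤ 2 * m)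
  simp only [Function.comp, ← hm, Real.norm_eq_abs]
  have hmpos : (0 : ℝ) < m := by exact_mod_cast hm1
  have hY : |Y (m ^ 2 + d) ω| ≤ |Y (m ^ 2) ω| + B * (2 * m) := by
    have h1 := abs_sub_abs_le_abs_sub (Y (m ^ 2 + d) ω) (Y (m ^ 2) ω)
    have h2 := hlip (m ^ 2) d
    have h3 := mul_le_mul_of_nonneg_left hd hB
    linarith
  have hden : (m : ℝ) ^ 2 ≤ ((m ^ 2 + d : ℕ) : ℝ) := by exact_mod_cast hmn
  rw [abs_div, abs_div, abs_of_pos (by positivity : (0 : ℝ) < (m : ℝ) ^ 2),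
    abs_of_pos (lt_of_lt_of_le (by positivity) hden)]
  calc _ ≤ (|Y (m ^ 2) ω| + B * (2 * m)) / (m : ℝ) ^ 2 := by gcongr
    _ = _ := by field_simp

/-- For a Markov chain with transition matrix `P` started at time `1` and an eigenfunction `φ` of
`P` with eigenvalue `ρ`, the increment `φ (X (k + 1)) - ρ φ (X k)` is orthogonal to every function
of `X 1, …, X k`. -/
theorem integral_mul_markov_increment_eq_zero {Ω α : Type*} [MeasurableSpace Ω] [Fintype α]
    [MeasurableSpace α] [MeasurableSingletonClass α]
    (μ : Measure Ω) [IsFiniteMeasure μ] (P : Matrix α α ℝ) (hP : ∀ x y, 0 ≤ P x y)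
    (X : ℕ → Ω → α) (hX : ∀ k, Measurable (X k))
    (k : ℕ) (hk : 1 ≤ k)
    (hmarkov : ∀ f : ℕ → α,
      μ (⋂ j ∈ Set.Icc 1 (k + 1), {ω | X j ω = f j})
        = μ (⋂ j ∈ Set.Icc 1 k, {ω | X j ω = f j}) * ENNReal.ofReal (P (f k) (f (k + 1))))
    (φ : α → ℝ) (ρ : ℝ) (hφ : ∀ x, ∑ y, P x y * φ y = ρ * φ x)
    (G : (ℕ → α) → ℝ) (hG : ∀ f g : ℕ → α, (∀ j ∈ Set.Icc 1 k, f j = g j) → G f = G g) :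
    ∫ ω, G (fun j => X j ω) * (φ (X (k + 1) ω) - ρ * φ (X k ω)) ∂μ = 0 := by
  classical
  have hφm : Measurable φ := measurable_of_finite φ
  let W : Ω → (Set.Icc 1 k → α) := fun ω j => X j ω
  have hW : Measurable W := measurable_pi_lambda _ fun j => hX j
  have hGW : ∃ G' : (Set.Icc 1 k → α) → ℝ, ∀ ω, G (fun j => X j ω) = G' (W ω) := by
    rcases isEmpty_or_nonempty Ω with h | ⟨⟨ω₀⟩⟩
    · exact ⟨0, fun ω => h.elim ω⟩
    refine ⟨fun w => G fun j => if h : j ∈ Set.Icc 1 k then w ⟨j, h⟩ else X 0 ω₀, fun ω => ?_⟩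
    refine hG _ _ fun j hj => ?_
    simp only [dif_pos hj, W]
  obtain ⟨G', hG'⟩ := hGW
  have hcyl : ∀ w : Set.Icc 1 k → α,
      ∫ ω in W ⁻¹' {w}, φ (X (k + 1) ω) ∂μ = μ.real (W ⁻¹' {w}) * (ρ * φ (w ⟨k, hk, le_rfl⟩)) := by
    intro w
    have hA : MeasurableSet (W ⁻¹' {w}) := hW (measurableSet_singleton w)
    have hb : ∀ b, μ.real (W ⁻¹' {w} ∩ X (k + 1) ⁻¹' {b})
        = μ.real (W ⁻¹' {w}) * P (w ⟨k, hk, le_rfl⟩) b := by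
      intro b
      have h := hmarkov fun j => if h : j ∈ Set.Icc 1 k then w ⟨j, h⟩ else b
      have e1 : (⋂ j ∈ Set.Icc 1 k,
          {ω | X j ω = if h : j ∈ Set.Icc 1 k then w ⟨j, h⟩ else b}) = W ⁻¹' {w} := by
        ext ω
        simp only [Set.mem_iInter, Set.mem_preimage, Set.mem_singleton_iff, Set.mem_ofPred_eq, W]
        constructor
        · intro h
          ext ⟨j, hj⟩
          simpa only [dif_pos hj] using h j hj
        · rintro rfl j hj
          simp only [dif_pos hj]
      have e2 : (⋂ j ∈ Set.Icc 1 (k + 1),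
          {ω | X j ω = if h : j ∈ Set.Icc 1 k then w ⟨j, h⟩ else b})
          = W ⁻¹' {w} ∩ X (k + 1) ⁻¹' {b} := by
        have hk1 : k + 1 ∉ Set.Icc 1 k := fun h => absurd h.2 (by omega)
        rw [← e1]
        ext ω
        simp only [Set.mem_iInter, Set.mem_inter_iff, Set.mem_preimage, Set.mem_singleton_iff,
          Set.mem_ofPred_eq]
        constructor
        · intro h
          refine ⟨fun j hj => h j ⟨hj.1, hj.2.trans k.le_succ⟩, ?_⟩
          simpa only [dif_neg hk1] using h (k + 1) ⟨by omega, le_rfl⟩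
        · rintro ⟨h1, h2⟩ j hj
          rcases eq_or_lt_of_le hj.2 with rfl | hlt
          · simpa only [dif_neg hk1] using h2
          · exact h1 j ⟨hj.1, by omega⟩
      rw [e1, e2] at h
      have hkmem : k ∈ Set.Icc 1 k := ⟨hk, le_rfl⟩
      have hk1 : k + 1 ∉ Set.Icc 1 k := fun h => absurd h.2 (by omega)
      simp only [dif_pos hkmem, dif_neg hk1] at h
      rw [measureReal_def, h, ENNReal.toReal_mul, ENNReal.toReal_ofReal (hP _ _), measureReal_def]
    have hmap : ∫ ω in W ⁻¹' {w}, φ (X (k + 1) ω) ∂μ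
        = ∫ x, φ x ∂((μ.restrict (W ⁻¹' {w})).map (X (k + 1))) :=
      (integral_map (hX _).aemeasurable hφm.aestronglyMeasurable).symm
    rw [hmap, integral_fintype .of_finite, ← hφ, Finset.mul_sum]
    refine Finset.sum_congr rfl fun b _ => ?_
    rw [map_measureReal_apply (hX _) (measurableSet_singleton b),
      measureReal_restrict_apply (hX _ (measurableSet_singleton b)), Set.inter_comm, hb,
      smul_eq_mul, mul_assoc]
  have hbdd : ∀ H : α → ℝ, ∀ j, Integrable (fun ω => H (X j ω)) μ := fun H j =>
    (Integrable.of_finite (f := H)).comp_measurable (hX j)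
  have hint : Integrable (fun ω => G (fun j => X j ω) * (φ (X (k + 1) ω) - ρ * φ (X k ω))) μ := by
    have : Integrable (fun z : (Set.Icc 1 k → α) × α =>
        G' z.1 * (φ z.2 - ρ * φ (z.1 ⟨k, hk, le_rfl⟩)))
        (μ.map fun ω => (W ω, X (k + 1) ω)) := .of_finite
    simp_rw [hG']
    exact this.comp_measurable (hW.prodMk (hX (k + 1)))
  have hpart : (⋃ w, W ⁻¹' {w}) = Set.univ := by
    ext ω; simp
  rw [← setIntegral_univ, ← hpart, integral_iUnion_fintype
    (fun w => hW (measurableSet_singleton w)) ?_ fun w => hint.integrableOn]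
  · refine Finset.sum_eq_zero fun w _ => ?_
    have hA : MeasurableSet (W ⁻¹' {w}) := hW (measurableSet_singleton w)
    have : ∫ ω in W ⁻¹' {w}, G (fun j => X j ω) * (φ (X (k + 1) ω) - ρ * φ (X k ω)) ∂μ
        = ∫ ω in W ⁻¹' {w}, G' w * (φ (X (k + 1) ω) - ρ * φ (w ⟨k, hk, le_rfl⟩)) ∂μ := by
      refine setIntegral_congr_fun hA fun ω hω => ?_
      have hω' : W ω = w := hω
      simp only [hG', hω', ← congrFun hω' ⟨k, hk, le_rfl⟩, W]
    rw [this, integral_const_mul, integral_sub (hbdd φ _).integrableOn (integrable_const _),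
      hcyl]
    simp
  · intro v w hvw
    exact Disjoint.preimage _ (by simpa using hvw)

/-- Law of large numbers for an eigenfunction, with eigenvalue `ρ ≠ 1`, of the transition matrix
of a finite Markov chain. -/
theorem ae_tendsto_sum_div_of_markov_eigenfunction {Ω α : Type*} [MeasurableSpace Ω] [Fintype α]
    [MeasurableSpace α] [MeasurableSingletonClass α]
    (μ : Measure Ω) [IsProbabilityMeasure μ] (P : Matrix α α ℝ) (hP : ∀ x y, 0 ≤ P x y)
    (X : ℕ → Ω → α) (hX : ∀ k, Measurable (X k))
    (hmarkov : ∀ k : ℕ, 1 ≤ k → ∀ f : ℕ → α,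
      μ (⋂ j ∈ Set.Icc 1 (k + 1), {ω | X j ω = f j})
        = μ (⋂ j ∈ Set.Icc 1 k, {ω | X j ω = f j}) * ENNReal.ofReal (P (f k) (f (k + 1))))
    (φ : α → ℝ) (ρ : ℝ) (hρ : ρ ≠ 1) (hφ : ∀ x, ∑ y, P x y * φ y = ρ * φ x) :
    ∀ᵐ ω ∂μ, Tendsto (fun n : ℕ => (∑ k ∈ Finset.Icc 1 n, φ (X k ω)) / n) atTop (𝓝 0) := by
  have hφm : Measurable φ := measurable_of_finite φ
  obtain ⟨K, hK⟩ : ∃ K, ∀ x, |φ x| ≤ K :=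
    ⟨∑ x, |φ x|, fun x => Finset.single_le_sum (f := fun x => |φ x|)
      (fun _ _ => abs_nonneg _) (Finset.mem_univ x)⟩
  let D : ℕ → Ω → ℝ := fun n ω => φ (X (n + 2) ω) - ρ * φ (X (n + 1) ω)
  let M : ℕ → Ω → ℝ := fun n ω => ∑ i ∈ Finset.range n, D i ω
  let B : ℝ := K + |ρ| * K
  have hD : ∀ n ω, |D n ω| ≤ B := fun n ω => by
    refine (abs_sub _ _).trans (add_le_add (hK _) ?_)
    rw [abs_mul]
    exact mul_le_mul_of_nonneg_left (hK _) (abs_nonneg _)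
  have hDm : ∀ n, Measurable (D n) := fun n =>
    (hφm.comp (hX _)).sub ((hφm.comp (hX _)).const_mul ρ)
  have hMm : ∀ n, Measurable (M n) := fun n => Finset.measurable_fun_sum _ fun i _ => hDm i
  have hM : ∀ n ω, |M n ω| ≤ n * B := fun n ω => by
    refine (Finset.abs_sum_le_sum_abs _ _).trans ((Finset.sum_le_sum fun i _ => hD i ω).trans ?_)
    simp
  have hMsucc : ∀ n ω, M (n + 1) ω = M n ω + D n ω := fun n ω => Finset.sum_range_succ _ _
  have hDL : ∀ n, MemLp (D n) 2 μ := fun n =>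
    MemLp.of_bound (hDm n).aestronglyMeasurable B (ae_of_all _ (hD n))
  have hML : ∀ n, MemLp (M n) 2 μ := fun n =>
    MemLp.of_bound (hMm n).aestronglyMeasurable (n * B) (ae_of_all _ (hM n))
  have horth : ∀ n, ∫ ω, M n ω * D n ω ∂μ = 0 := fun n => by
    refine integral_mul_markov_increment_eq_zero μ P hP X hX (n + 1) (by omega)
      (hmarkov (n + 1) (by omega)) φ ρ hφ
      (fun f => ∑ i ∈ Finset.range n, (φ (f (i + 2)) - ρ * φ (f (i + 1)))) fun f g hfg => ?_
    refine Finset.sum_congr rfl fun i hi => ?_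
    have := Finset.mem_range.mp hi
    rw [hfg (i + 2) ⟨by omega, by omega⟩, hfg (i + 1) ⟨by omega, by omega⟩]
  have hsq : ∀ n : ℕ, ∫ ω, M n ω ^ 2 ∂μ ≤ B ^ 2 * n := by
    intro n
    induction n with
    | zero => simp [M]
    | succ n ih =>
      have hexp : ∀ ω, M (n + 1) ω ^ 2 = M n ω ^ 2 + 2 * (M n ω * D n ω) + D n ω ^ 2 := fun ω => by
        rw [hMsucc]; ring
      have hi : Integrable (fun ω => M n ω * D n ω) μ := (hML n).integrable_mul (hDL n)
      have hi' : Integrable (fun ω => M n ω ^ 2 + 2 * (M n ω * D n ω)) μ :=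
        (hML n).integrable_sq.add (hi.const_mul 2)
      have hDsq : ∫ ω, D n ω ^ 2 ∂μ ≤ B ^ 2 := by
        have : ∫ ω, D n ω ^ 2 ∂μ ≤ ∫ _, B ^ 2 ∂μ :=
          integral_mono (hDL n).integrable_sq (integrable_const _)
            fun ω => sq_le_sq' (abs_le.mp (hD n ω)).1 (abs_le.mp (hD n ω)).2
        simpa using this
      simp_rw [hexp]
      rw [integral_add hi' (hDL n).integrable_sq,
        integral_add (hML n).integrable_sq (hi.const_mul 2), integral_const_mul, horth]
      push_cast
      linarith
  filter_upwards [ae_tendsto_div_of_integral_sq_le μ M hMm B (B ^ 2)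
    (fun n ω => by rw [hMsucc, add_sub_cancel_left]; exact hD n ω)
    (fun n => (hML n).integrable_sq) hsq] with ω hω
  have hρ' : 1 - ρ ≠ 0 := sub_ne_zero.mpr hρ.symm
  have htel : ∀ n, M n ω
      = (1 - ρ) * ∑ k ∈ Finset.Icc 1 n, φ (X k ω) + (φ (X (n + 1) ω) - φ (X 1 ω)) := by
    intro n
    induction n with
    | zero => simp [M]
    | succ n ih =>
      rw [hMsucc, ih, Finset.sum_Icc_succ_top (by omega)]
      simp only [D]
      ring
  have hbd : Tendsto (fun n : ℕ => (φ (X (n + 1) ω) - φ (X 1 ω)) / n) atTop (𝓝 0) := by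
    refine squeeze_zero_norm (fun n => ?_) (tendsto_const_div_atTop_nhds_zero_nat (K + K))
    rw [Real.norm_eq_abs, abs_div, Nat.abs_cast]
    gcongr
    exact (abs_sub _ _).trans (add_le_add (hK _) (hK _))
  have hlim := (hω.sub hbd).div_const (1 - ρ)
  rw [sub_zero, zero_div] at hlim
  refine hlim.congr fun n => ?_
  rw [htel, ← sub_div, add_sub_cancel_right, mul_div_assoc, mul_div_cancel_left₀ _ hρ']

/-- Law of Large Numbers for the general compound Hawkes process with two-state
dependent orders (Corollary "LLN for GCHP2SDO"): for every `t ≥ 0`,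
`S_{nt}/n → (a₁π₁* + a₂π₂*) c t` almost surely as `n → ∞`. -/
theorem LLN_GCHP2SDO
    {Ω : Type*} [MeasurableSpace Ω] (Pr : Measure Ω) [IsProbabilityMeasure Pr]
    (p p' : ℝ) (hp : 0 < p) (hp1 : p < 1) (hp' : 0 < p') (hp'1 : p' < 1)
    (P : Matrix (Fin 2) (Fin 2) ℝ) (hP : P = !![p, 1 - p; 1 - p', p'])
    (π₁ π₂ : ℝ) (hπ₁pos : 0 < π₁) (hπ₂pos : 0 < π₂) (hπsum : π₁ + π₂ = 1)
    (hπstat₁ : π₁ * p + π₂ * (1 - p') = π₁)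
    (hπstat₂ : π₁ * (1 - p) + π₂ * p' = π₂)
    (X : ℕ → Ω → Fin 2)
    (hXmeas : ∀ k, Measurable (X k))
    (hXmarkov : ∀ k : ℕ, 1 ≤ k → ∀ f : ℕ → Fin 2,
      Pr (⋂ j ∈ Set.Icc 1 (k + 1), {ω | X j ω = f j})
        = Pr (⋂ j ∈ Set.Icc 1 k, {ω | X j ω = f j}) * ENNReal.ofReal (P (f k) (f (k + 1))))
    (a₁ a₂ : ℝ) (a : Fin 2 → ℝ) (ha : a = ![a₁, a₂])
    (N : ℝ → Ω → ℕ)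
    (hNmeas : ∀ t, Measurable (N t))
    (hN0 : ∀ ω, N 0 ω = 0)
    (hNmono : ∀ ω, Monotone (fun t => N t ω))
    (hNrc : ∀ ω t, ContinuousWithinAt (fun s => (N s ω : ℝ)) (Set.Ici t) t)
    (c : ℝ) (hc : 0 < c)
    (hNLLN : ∀ᵐ ω ∂Pr, Tendsto (fun t : ℝ => (N t ω : ℝ) / t) atTop (𝓝 c))
    (hindep : IndepFun (fun ω (t : ℝ) => N t ω) (fun ω (k : ℕ) => X k ω) Pr)
    (S0 : ℝ) (S : ℝ → Ω → ℝ)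
    (hS : ∀ t ω, S t ω = S0 + ∑ k ∈ Finset.Icc 1 (N t ω), a (X k ω))
    (t : ℝ) (ht : 0 ≤ t) :
    ∀ᵐ ω ∂Pr, Tendsto (fun n : ℕ => S (n * t) ω / n)
      atTop (𝓝 ((a₁ * π₁ + a₂ * π₂) * c * t)) := by
  let φ : Fin 2 → ℝ := ![π₂, -π₁]
  have hPnonneg : ∀ x y, 0 ≤ P x y := by
    intro x y
    rw [hP]
    fin_cases x <;> fin_cases y <;> simp <;> linarith
  have hφ : ∀ x, ∑ y, P x y * φ y = (p + p' - 1) * φ x := by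
    intro x
    rw [hP]
    fin_cases x <;> simp [φ] <;> linarith
  have haφ : ∀ x, a x = (a₁ * π₁ + a₂ * π₂) + (a₁ - a₂) * φ x := by
    obtain rfl : π₂ = 1 - π₁ := by linarith
    intro x
    rw [ha]
    fin_cases x <;> simp [φ] <;> ring
  filter_upwards [hNLLN, ae_tendsto_sum_div_of_markov_eigenfunction Pr P hPnonneg X hXmeas hXmarkov
    φ (p + p' - 1) (by linarith) hφ] with ω hN hV
  have hS0 : Tendsto (fun n : ℕ => S0 / (n : ℝ)) atTop (𝓝 0) :=
    tendsto_const_div_atTop_nhds_zero_nat S0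
  rcases ht.eq_or_lt with rfl | htpos
  · simpa [hS, hN0] using hS0
  have hnt : Tendsto (fun n : ℕ => (n : ℝ) * t) atTop atTop :=
    tendsto_natCast_atTop_atTop.atTop_mul_const htpos
  have hNn : Tendsto (fun n : ℕ => (N (n * t) ω : ℝ) / n) atTop (𝓝 (c * t)) := by
    refine ((hN.comp hnt).mul_const t).congr fun n => ?_
    simp only [Function.comp]
    field_simp
  have hNtop : Tendsto (fun n : ℕ => N (n * t) ω) atTop atTop := by
    rw [← tendsto_natCast_atTop_iff (R := ℝ)]
    refine (hNn.pos_mul_atTop (mul_pos hc htpos) tendsto_natCast_atTop_atTop).congr' ?_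
    filter_upwards [eventually_ge_atTop 1] with n hn
    exact div_mul_cancel₀ _ (by positivity)
  have hlim := (hS0.add (hNn.const_mul (a₁ * π₁ + a₂ * π₂))).add
    (((hV.comp hNtop).mul hNn).const_mul (a₁ - a₂))
  rw [zero_add, zero_mul, mul_zero, add_zero, ← mul_assoc] at hlim
  refine hlim.congr' ?_
  filter_upwards [hNtop.eventually_ge_atTop 1] with n hn
  have hn0 : (N (n * t) ω : ℝ) ≠ 0 := by positivity
  simp only [Function.comp, hS, haφ, Finset.sum_add_distrib, ← Finset.mul_sum, Finset.sum_const,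
    Nat.card_Icc, nsmul_eq_mul, Nat.add_sub_cancel]
  field_simp
  ring
end

section
/- Diffusion limit for the compound Hawkes process with dependent orders and fixed tick size (Corollary 'Diffusion Limit for CHPDO'): For every t > 0, (S_{nt} − N_{nt}·a*)/√n converges in distribution, as n → ∞, to a centered Gaussian random variable with variance σ²·c·t, where a* := δ(2π* − 1) and σ² := 4δ²((1 − p' + π*(p' − p))/(p + p' − 2)² − π*(1 − π*)). -/
open MeasureTheory ProbabilityTheory Filter Finset Matrix Topology

section MarkovChain

variable {E : Type*} [Fintype E]

/-- If the centred observable `b` admits a first-order corrector `g` and a second-order corrector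
`k`, then `1 + iθg + θ²k` is an eigenvector of the tilted transition operator with eigenvalue
`exp (-θ²v/2)`, up to `O(θ³)`. -/
lemma isBigO_tilted_eigenvector (P : Matrix E E ℝ) (hPsum : ∀ x, ∑ y, P x y = 1)
    (b g k : E → ℝ) (v : ℝ) (hg : ∀ x, ∑ y, P x y * (b y + g y) = g x)
    (hk : ∀ x, ∑ y, P x y * (k y - b y ^ 2 / 2 - b y * g y) = k x - v / 2) (x : E) :
    (fun θ : ℝ => ∑ y, (P x y : ℂ) * (Complex.exp (θ * b y * Complex.I) *
        (1 + θ * g y * Complex.I + θ ^ 2 * k y))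
      - Complex.exp (-(θ ^ 2 * v / 2)) * (1 + θ * g x * Complex.I + θ ^ 2 * k x))
      =O[𝓝 0] fun θ : ℝ => θ ^ 3 := by
  set R : E → ℝ → ℂ := fun y θ => Complex.exp (θ * b y * Complex.I)
    - (1 + θ * b y * Complex.I - θ ^ 2 * b y ^ 2 / 2) with hR
  set Q : ℝ → ℂ := fun θ => Complex.exp (-(θ ^ 2 * v / 2)) - (1 - θ ^ 2 * v / 2) with hQ
  have hRO : ∀ y, R y =O[𝓝 0] fun θ : ℝ => θ ^ 3 := by
    intro y
    have ht : Tendsto (fun θ : ℝ => (θ * b y * Complex.I : ℂ)) (𝓝 0) (𝓝 0) := by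
      have : Continuous (fun θ : ℝ => (θ * b y * Complex.I : ℂ)) := by fun_prop
      simpa using this.tendsto 0
    have h1 := (Complex.exp_sub_sum_range_isBigO_pow 3).comp_tendsto ht
    have h2 : (fun θ : ℝ => (θ * b y * Complex.I : ℂ) ^ 3) =O[𝓝 0] fun θ : ℝ => θ ^ 3 := by
      refine Asymptotics.IsBigO.of_bound (|b y| ^ 3) (Eventually.of_forall fun θ => ?_)
      simp [mul_pow, mul_comm]
    refine (h1.trans h2).congr_left fun θ => ?_
    simp only [hR, Function.comp, Finset.sum_range_succ, Finset.sum_range_zero]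
    simp [mul_pow, Nat.factorial]
    ring
  have hQO : Q =O[𝓝 0] fun θ : ℝ => θ ^ 3 := by
    have ht : Tendsto (fun θ : ℝ => (-(θ ^ 2 * v / 2) : ℂ)) (𝓝 0) (𝓝 0) := by
      have : Continuous (fun θ : ℝ => (-(θ ^ 2 * v / 2) : ℂ)) := by fun_prop
      simpa using this.tendsto 0
    have h1 := (Complex.exp_sub_sum_range_isBigO_pow 2).comp_tendsto ht
    have h2 : (fun θ : ℝ => (-(θ ^ 2 * v / 2) : ℂ) ^ 2) =O[𝓝 0] fun θ : ℝ => θ ^ 4 := by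
      refine Asymptotics.IsBigO.of_bound ((|v| / 2) ^ 2) (Eventually.of_forall fun θ => le_of_eq ?_)
      simp [mul_pow, div_pow, ← pow_mul]
      ring
    have h3 : (fun θ : ℝ => θ ^ 4) =O[𝓝 0] fun θ : ℝ => θ ^ 3 :=
      (Asymptotics.isLittleO_pow_pow (by norm_num)).isBigO
    refine (h1.trans (h2.trans h3)).congr_left fun θ => ?_
    simp only [hQ, Function.comp, Finset.sum_range_succ, Finset.sum_range_zero]
    simp
    ring
  have hbdd : ∀ f : ℝ → ℂ, Continuous f → f =O[𝓝 0] fun _ : ℝ => (1 : ℝ) := fun f hf =>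
    (hf.tendsto 0).isBigO_one ℝ
  have hh : ∀ y, (fun θ : ℝ => (1 + θ * g y * Complex.I + θ ^ 2 * k y : ℂ))
      =O[𝓝 0] fun _ : ℝ => (1 : ℝ) := fun y => hbdd _ (by fun_prop)
  set q : ℝ → ℂ := fun θ => ∑ y, (P x y : ℂ) * (b y * k y * Complex.I
      - b y ^ 2 / 2 * g y * Complex.I - θ * b y ^ 2 / 2 * k y)
      + v / 2 * (g x * Complex.I + θ * k x) with hq
  have hqO := hbdd q (by fun_prop)
  have hcube : (fun θ : ℝ => (θ : ℂ) ^ 3) =O[𝓝 0] fun θ : ℝ => θ ^ 3 :=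
    Asymptotics.IsBigO.of_bound 1 (Eventually.of_forall fun θ => by simp)
  have key : (fun θ : ℝ => ∑ y, (P x y : ℂ) * (R y θ * (1 + θ * g y * Complex.I + θ ^ 2 * k y))
      - Q θ * (1 + θ * g x * Complex.I + θ ^ 2 * k x) + (θ : ℂ) ^ 3 * q θ)
      =O[𝓝 0] fun θ : ℝ => θ ^ 3 := by
    refine (Asymptotics.IsBigO.sub (Asymptotics.IsBigO.fun_sum fun y _ => ?_) ?_).add ?_
    · simpa using ((hRO y).mul (hh y)).const_mul_left (P x y : ℂ)
    · simpa using hQO.mul (hh x)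
    · simpa using hcube.mul hqO
  refine key.congr_left fun θ => ?_
  have e0 : ∑ y, (P x y : ℂ) = 1 := by exact_mod_cast hPsum x
  have e1 : ∑ y, (P x y : ℂ) * (b y + g y) = g x := by exact_mod_cast hg x
  have e2 : ∑ y, (P x y : ℂ) * ((k y : ℂ) - (b y : ℂ) ^ 2 / 2 - b y * g y) = (k x : ℂ) - v / 2 := by
    exact_mod_cast hk x
  have expand : ∑ y, (P x y : ℂ) * (Complex.exp (θ * b y * Complex.I) *
        (1 + θ * g y * Complex.I + θ ^ 2 * k y))
      = ∑ y, (P x y : ℂ) + θ * Complex.I * ∑ y, (P x y : ℂ) * (b y + g y)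
        + θ ^ 2 * ∑ y, (P x y : ℂ) * ((k y : ℂ) - (b y : ℂ) ^ 2 / 2 - b y * g y)
        + θ ^ 3 * ∑ y, (P x y : ℂ) * (b y * k y * Complex.I
          - b y ^ 2 / 2 * g y * Complex.I - θ * b y ^ 2 / 2 * k y)
        + ∑ y, (P x y : ℂ) * (R y θ * (1 + θ * g y * Complex.I + θ ^ 2 * k y)) := by
    simp only [Finset.mul_sum, ← Finset.sum_add_distrib]
    refine Finset.sum_congr rfl fun y _ => ?_
    simp only [hR]
    linear_combination ((P x y : ℂ) * θ ^ 2 * b y * g y) * Complex.I_sq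
  rw [expand, e0, e1, e2]
  simp only [hq, hQ]
  ring

variable {Ω : Type*} [MeasurableSpace Ω] {Pr : Measure Ω} [IsProbabilityMeasure Pr]

/-- The Markov property, stated through cylinder probabilities, in integrated form. -/
lemma integral_markov_step [MeasurableSpace E] [DiscreteMeasurableSpace E]
    (P : Matrix E E ℝ) (hPnn : ∀ x y, 0 ≤ P x y)
    (X : ℕ → Ω → E) (hXmeas : ∀ k, Measurable (X k))
    (hXmarkov : ∀ k : ℕ, 1 ≤ k → ∀ f : ℕ → E,
      Pr (⋂ j ∈ Set.Icc 1 (k + 1), {ω | X j ω = f j})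
        = Pr (⋂ j ∈ Set.Icc 1 k, {ω | X j ω = f j}) * ENNReal.ofReal (P (f k) (f (k + 1))))
    (k : ℕ) (hk : 1 ≤ k) (G : (Finset.Icc 1 k → E) → ℂ) (u : E → ℂ) :
    ∫ ω, G (fun j => X j ω) * u (X (k + 1) ω) ∂Pr
      = ∫ ω, G (fun j => X j ω) * ∑ y, (P (X k ω) y : ℂ) * u y ∂Pr := by
  have hV : Measurable (fun ω => (fun j : Finset.Icc 1 k => X j ω)) := by fun_prop
  have hVX : Measurable (fun ω => ((fun j : Finset.Icc 1 k => X j ω), X (k + 1) ω)) := by fun_prop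
  have hkk : k ∈ Finset.Icc 1 k := by simp [hk]
  have hcyl : ∀ (f : Finset.Icc 1 k → E) (y : E),
      (Pr.map (fun ω => ((fun j : Finset.Icc 1 k => X j ω), X (k + 1) ω))).real {(f, y)}
        = (Pr.map (fun ω => (fun j : Finset.Icc 1 k => X j ω))).real {f} * P (f ⟨k, hkk⟩) y := by
    intro f y
    have h := hXmarkov k hk (fun j => if hj : j ∈ Finset.Icc 1 k then f ⟨j, hj⟩ else y)
    have s1 : (⋂ j ∈ Set.Icc 1 k, {ω | X j ω =
        (fun j => if hj : j ∈ Finset.Icc 1 k then f ⟨j, hj⟩ else y) j})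
        = (fun ω => (fun j : Finset.Icc 1 k => X j ω)) ⁻¹' {f} := by
      ext ω
      simp only [Set.mem_iInter, Set.mem_ofPred_eq, Set.mem_preimage, Set.mem_singleton_iff,
        funext_iff, Subtype.forall]
      refine forall_congr' fun j => ⟨fun h hj => ?_, fun h hj => ?_⟩
      · exact (h (Finset.mem_Icc.1 hj)).trans (dif_pos hj)
      · rw [dif_pos (show j ∈ Finset.Icc 1 k from Finset.mem_Icc.2 hj)]
        exact h _
    have s2 : (⋂ j ∈ Set.Icc 1 (k + 1), {ω | X j ω =
        (fun j => if hj : j ∈ Finset.Icc 1 k then f ⟨j, hj⟩ else y) j})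
        = (fun ω => ((fun j : Finset.Icc 1 k => X j ω), X (k + 1) ω)) ⁻¹' {(f, y)} := by
      have hI : Set.Icc 1 (k + 1) = insert (k + 1) (Set.Icc 1 k) := by
        ext j; simp only [Set.mem_Icc, Set.mem_insert_iff]; omega
      rw [hI, Set.biInter_insert, s1]
      ext ω
      simp [and_comm]
    rw [s1, s2, dif_pos hkk, dif_neg (by simp)] at h
    rw [map_measureReal_apply hVX (measurableSet_singleton _),
      map_measureReal_apply hV (measurableSet_singleton _), measureReal_def, measureReal_def, h,
      ENNReal.toReal_mul, ENNReal.toReal_ofReal (hPnn _ _)]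
  have : IsProbabilityMeasure (Pr.map (fun ω => (fun j : Finset.Icc 1 k => X j ω))) :=
    Measure.isProbabilityMeasure_map hV.aemeasurable
  have : IsProbabilityMeasure
      (Pr.map (fun ω => ((fun j : Finset.Icc 1 k => X j ω), X (k + 1) ω))) :=
    Measure.isProbabilityMeasure_map hVX.aemeasurable
  have l := integral_map (μ := Pr) hVX.aemeasurable
    (f := fun z : (Finset.Icc 1 k → E) × E => G z.1 * u z.2)
    (by fun_prop)
  have r := integral_map (μ := Pr) hV.aemeasurable
    (f := fun z : Finset.Icc 1 k → E => G z * ∑ y, (P (z ⟨k, hkk⟩) y : ℂ) * u y)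
    (by fun_prop)
  rw [← l, ← r, integral_fintype .of_finite, integral_fintype .of_finite,
    Fintype.sum_prod_type]
  refine Finset.sum_congr rfl fun f _ => ?_
  simp only [hcyl, Finset.mul_sum, Finset.smul_sum, Complex.real_smul]
  refine Finset.sum_congr rfl fun y _ => ?_
  push_cast
  ring

/-- Gaussian approximation of the characteristic function of the partial sums, uniformly in the
number of terms. -/
lemma exists_norm_charFun_sum_sub_le [MeasurableSpace E] [DiscreteMeasurableSpace E]
    (P : Matrix E E ℝ) (hPnn : ∀ x y, 0 ≤ P x y) (hPsum : ∀ x, ∑ y, P x y = 1)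
    (X : ℕ → Ω → E) (hXmeas : ∀ k, Measurable (X k))
    (hXmarkov : ∀ k : ℕ, 1 ≤ k → ∀ f : ℕ → E,
      Pr (⋂ j ∈ Set.Icc 1 (k + 1), {ω | X j ω = f j})
        = Pr (⋂ j ∈ Set.Icc 1 k, {ω | X j ω = f j}) * ENNReal.ofReal (P (f k) (f (k + 1))))
    (b g k : E → ℝ) (v : ℝ) (hv : 0 ≤ v) (hg : ∀ x, ∑ y, P x y * (b y + g y) = g x)
    (hk : ∀ x, ∑ y, P x y * (k y - b y ^ 2 / 2 - b y * g y) = k x - v / 2) :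
    ∃ C : ℝ, ∀ᶠ θ : ℝ in 𝓝 0, ∀ m : ℕ,
      ‖∫ ω, Complex.exp (θ * (∑ j ∈ Finset.Icc 1 m, b (X j ω) : ℝ) * Complex.I) ∂Pr
        - Complex.exp (-(m * (θ ^ 2 * v / 2)))‖ ≤ C * (|θ| + m * |θ| ^ 3) := by
  obtain ⟨C₁, hC₁pos, hC₁⟩ :=
    (Asymptotics.isBigO_pi.2 (isBigO_tilted_eigenvector P hPsum b g k v hg hk)).exists_pos
  set B : ℝ := ∑ x, (|g x| + |k x|)
  set A : ℝ := ∑ x, |b x|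
  have hB0 : 0 ≤ B := by positivity
  have hA0 : 0 ≤ A := by positivity
  refine ⟨2 * B + A + v / 2 + C₁, ?_⟩
  have hsmall : ∀ᶠ θ : ℝ in 𝓝 0, |θ| ≤ 1 := by
    filter_upwards [Metric.closedBall_mem_nhds (0 : ℝ) one_pos] with θ hθ
    simpa using hθ
  filter_upwards [hC₁.bound, hsmall] with θ hθ hθ1 m
  set h : E → ℂ := fun x => 1 + θ * g x * Complex.I + θ ^ 2 * k x with hh
  set e : ℕ → Ω → ℂ := fun m ω =>
    Complex.exp (θ * (∑ j ∈ Finset.Icc 1 m, b (X j ω) : ℝ) * Complex.I) with he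
  set w : ℝ := θ ^ 2 * v / 2 with hw
  have hw0 : 0 ≤ w := by positivity
  have hθsq : θ ^ 2 ≤ |θ| := by
    rw [← sq_abs]; nlinarith [abs_nonneg θ]
  have hh1 : ∀ x, ‖h x - 1‖ ≤ B * |θ| := by
    intro x
    have h1 : ‖h x - 1‖ ≤ |θ| * |g x| + θ ^ 2 * |k x| := by
      have : h x - 1 = θ * g x * Complex.I + θ ^ 2 * k x := by simp only [hh]; ring
      rw [this]
      refine (norm_add_le _ _).trans (le_of_eq ?_)
      simp
    have h2 : |g x| + |k x| ≤ B :=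
      Finset.single_le_sum (f := fun x => |g x| + |k x|) (fun _ _ => by positivity)
        (Finset.mem_univ x)
    nlinarith [abs_nonneg θ, abs_nonneg (g x), abs_nonneg (k x)]
  have hen : ∀ m ω, ‖e m ω‖ = 1 := fun m ω => by
    simp only [he, ← Complex.ofReal_mul, Complex.norm_exp_ofReal_mul_I]
  have hem : ∀ m, Measurable (e m) := fun m => by
    have hb : ∀ j, Measurable fun ω => b (X j ω) := fun j =>
      (Measurable.of_discrete (f := b)).comp (hXmeas j)
    fun_prop
  have hint : ∀ m (u : E → ℂ) (i : ℕ), Integrable (fun ω => e m ω * u (X i ω)) Pr := by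
    intro m u i
    have hu : Measurable fun ω => u (X i ω) := (Measurable.of_discrete (f := u)).comp (hXmeas i)
    refine Integrable.of_bound ((hem m).mul hu).aestronglyMeasurable (∑ x, ‖u x‖)
      (Eventually.of_forall fun ω => ?_)
    rw [norm_mul, hen, one_mul]
    exact Finset.single_le_sum (f := fun x => ‖u x‖) (fun _ _ => norm_nonneg _)
      (Finset.mem_univ _)
  have hinte : ∀ m, Integrable (e m) Pr := fun m => by simpa using hint m (fun _ => 1) 0
  set Z : ℕ → ℂ := fun m => ∫ ω, e m ω * h (X m ω) ∂Pr with hZ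
  have hZe : ∀ m, ‖∫ ω, e m ω ∂Pr - Z m‖ ≤ B * |θ| := by
    intro m
    rw [hZ, ← integral_sub (hinte m) (hint m h m)]
    refine (norm_integral_le_of_norm_le_const (C := B * |θ|)
      (Eventually.of_forall fun ω => ?_)).trans (by simp)
    rw [← mul_one_sub, norm_mul, hen, one_mul, norm_sub_rev]
    exact hh1 _
  have hstep : ∀ m, 1 ≤ m → ‖Z (m + 1) - Complex.exp (-w) * Z m‖ ≤ C₁ * |θ| ^ 3 := by
    intro m hm
    have h1 : Z (m + 1) = ∫ ω, e m ω * ∑ y, (P (X m ω) y : ℂ) *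
        (Complex.exp (θ * b y * Complex.I) * h y) ∂Pr := by
      have h2 := integral_markov_step P hPnn X hXmeas hXmarkov m hm
        (fun f => Complex.exp (θ * (∑ j, b (f j) : ℝ) * Complex.I))
        (fun y => Complex.exp (θ * b y * Complex.I) * h y)
      have h3 : ∀ ω, ∑ j : Finset.Icc 1 m, b (X j ω) = ∑ j ∈ Finset.Icc 1 m, b (X j ω) :=
        fun ω => Finset.sum_coe_sort (Finset.Icc 1 m) fun j => b (X j ω)
      simp only [h3] at h2
      rw [← h2]
      refine integral_congr_ae (Eventually.of_forall fun ω => ?_)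
      simp only [he]
      rw [← mul_assoc, ← Complex.exp_add, Finset.sum_Icc_succ_top (by omega)]
      push_cast
      ring_nf
    rw [h1, hZ, ← integral_const_mul, ← integral_sub
      (hint m (fun x => ∑ y, (P x y : ℂ) * (Complex.exp (θ * b y * Complex.I) * h y)) m)
      ((hint m h m).const_mul _)]
    refine (norm_integral_le_of_norm_le_const (C := C₁ * |θ| ^ 3)
      (Eventually.of_forall fun ω => ?_)).trans (by simp)
    have h4 := (norm_le_pi_norm _ (X m ω)).trans hθ
    rw [mul_left_comm, ← mul_sub, norm_mul, hen, one_mul]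
    simpa [hw, hh] using h4
  have hbase : ‖Z 1 - Complex.exp (-w)‖ ≤ (B + A + v / 2) * |θ| := by
    have h1 : ‖∫ ω, e 1 ω ∂Pr - 1‖ ≤ A * |θ| := by
      have : ∫ ω, e 1 ω ∂Pr - 1 = ∫ ω, (e 1 ω - 1) ∂Pr := by
        rw [integral_sub (hinte 1) (integrable_const _)]; simp
      rw [this]
      refine (norm_integral_le_of_norm_le_const (C := A * |θ|)
        (Eventually.of_forall fun ω => ?_)).trans (by simp)
      have h2 := Real.norm_exp_I_mul_ofReal_sub_one_le (x := θ * b (X 1 ω))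
      have h3 : |b (X 1 ω)| ≤ A :=
        Finset.single_le_sum (f := fun x => |b x|) (fun _ _ => abs_nonneg _) (Finset.mem_univ _)
      have h4 : e 1 ω = Complex.exp (Complex.I * (θ * b (X 1 ω) : ℝ)) := by
        simp [he, mul_comm]
      rw [h4]
      refine h2.trans ?_
      rw [Real.norm_eq_abs, abs_mul, mul_comm]
      gcongr
    have h2 : ‖(1 : ℂ) - Complex.exp (-w)‖ ≤ v / 2 * |θ| := by
      rw [← Complex.ofReal_neg, ← Complex.ofReal_exp, ← Complex.ofReal_one, ← Complex.ofReal_sub,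
        Complex.norm_real, Real.norm_eq_abs, abs_of_nonneg (by simpa using hw0)]
      have := Real.add_one_le_exp (-w)
      nlinarith
    have h3 := hZe 1
    rw [norm_sub_rev] at h3
    have h4 : Z 1 - Complex.exp (-w) = (Z 1 - ∫ ω, e 1 ω ∂Pr) + (∫ ω, e 1 ω ∂Pr - 1)
      + (1 - Complex.exp (-w)) := by ring
    rw [h4]
    refine (norm_add₃_le).trans ?_
    linarith
  have hexp : ‖Complex.exp (-w)‖ ≤ 1 := by
    rw [← Complex.ofReal_neg, Complex.norm_exp_ofReal]
    simpa using hw0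
  have hind : ∀ m : ℕ, ‖Z (m + 1) - Complex.exp (-((m + 1 : ℕ) * w))‖
      ≤ (B + A + v / 2) * |θ| + m * (C₁ * |θ| ^ 3) := by
    intro m
    induction m with
    | zero => simpa using hbase
    | succ m ih =>
      have h1 : Z (m + 1 + 1) - Complex.exp (-((m + 1 + 1 : ℕ) * w))
          = (Z (m + 1 + 1) - Complex.exp (-w) * Z (m + 1))
            + Complex.exp (-w) * (Z (m + 1) - Complex.exp (-((m + 1 : ℕ) * w))) := by
        rw [mul_sub, ← Complex.exp_add]
        push_cast
        ring_nf
      rw [h1]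
      refine (norm_add_le _ _).trans ?_
      rw [norm_mul]
      have h2 := hstep (m + 1) (by omega)
      have h3 := mul_le_mul hexp ih (norm_nonneg _) zero_le_one
      push_cast at h3 ⊢
      linarith
  rcases m with _ | m
  · simp
    positivity
  · have h1 := hind m
    have h2 := hZe (m + 1)
    have h3 := norm_add_le (∫ ω, e (m + 1) ω ∂Pr - Z (m + 1))
      (Z (m + 1) - Complex.exp (-((m + 1 : ℕ) * w)))
    rw [sub_add_sub_cancel] at h3
    have hwc : (w : ℂ) = θ ^ 2 * v / 2 := by simp [hw]
    rw [← hwc]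
    refine h3.trans ((add_le_add h2 h1).trans ?_)
    have hx : 0 ≤ |θ| := abs_nonneg θ
    have h5 : 0 ≤ C₁ * |θ| + (2 * B + A + v / 2) * ((m + 1 : ℝ) * |θ| ^ 3) + C₁ * |θ| ^ 3 := by
      positivity
    push_cast
    linarith

end MarkovChain

/-- Passing from uniform Gaussian estimates on deterministic horizons to a random horizon growing
linearly. -/
lemma tendsto_integral_random_horizon {Ω : Type*} [MeasurableSpace Ω] {Pr : Measure Ω}
    [IsProbabilityMeasure Pr] (ψ : ℝ → ℕ → ℂ) (hψ : ∀ θ m, ‖ψ θ m‖ ≤ 1) (C v : ℝ)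
    (hC : ∀ᶠ θ : ℝ in 𝓝 0, ∀ m : ℕ,
      ‖ψ θ m - Complex.exp (-(m * (θ ^ 2 * v / 2)))‖ ≤ C * (|θ| + m * |θ| ^ 3))
    (M : ℕ → Ω → ℕ) (hM : ∀ n, Measurable (M n)) (τ : ℝ)
    (hMlim : ∀ᵐ ω ∂Pr, Tendsto (fun n : ℕ => (M n ω : ℝ) / n) atTop (𝓝 τ)) (s : ℝ) :
    Tendsto (fun n : ℕ => ∫ ω, ψ (s / √n) (M n ω) ∂Pr) atTop
      (𝓝 (Complex.exp (-(v * τ * s ^ 2 / 2)))) := by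
  have hθ : Tendsto (fun n : ℕ => s / √(n : ℝ)) atTop (𝓝 0) :=
    (Real.tendsto_sqrt_atTop.comp tendsto_natCast_atTop_atTop).const_div_atTop s
  have hconst : Complex.exp (-(v * τ * s ^ 2 / 2))
      = ∫ _, Complex.exp (-(v * τ * s ^ 2 / 2)) ∂Pr := by simp
  rw [hconst]
  refine tendsto_integral_of_dominated_convergence (fun _ => 1)
    (fun n => ((Measurable.of_discrete (f := ψ (s / √n))).comp (hM n)).aestronglyMeasurable)
    (integrable_const _) (fun n => Eventually.of_forall fun ω => hψ _ _) ?_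
  filter_upwards [hMlim] with ω hω
  have hsq : Tendsto (fun n : ℕ => (M n ω : ℝ) * (s / √n) ^ 2) atTop (𝓝 (τ * s ^ 2)) := by
    refine (hω.mul_const (s ^ 2)).congr fun n => ?_
    rw [div_pow, Real.sq_sqrt (Nat.cast_nonneg n)]
    ring
  have hmain : Tendsto (fun n : ℕ => Complex.exp (-(M n ω * (((s / √n : ℝ) : ℂ) ^ 2 * v / 2))))
      atTop (𝓝 (Complex.exp (-(v * τ * s ^ 2 / 2)))) := by
    have h1 : Tendsto (fun n : ℕ => Complex.exp ((-((M n ω : ℝ) * (s / √n) ^ 2 * v / 2) : ℝ)))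
        atTop (𝓝 (Complex.exp ((-(τ * s ^ 2 * v / 2) : ℝ)))) :=
      (Complex.continuous_exp.comp Complex.continuous_ofReal).continuousAt.tendsto.comp
        ((hsq.mul_const v).div_const 2).neg
    convert h1 using 3
    · push_cast; ring
    · push_cast; ring
  have hbound : Tendsto (fun n : ℕ => C * (|s / √n| + M n ω * |s / √n| ^ 3)) atTop (𝓝 0) := by
    have h1 := (hθ.abs.add (hsq.mul hθ.abs)).const_mul C
    simp only [abs_zero, mul_zero, add_zero] at h1
    refine h1.congr fun n => ?_
    rw [← sq_abs (s / √n)]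
    ring
  have hdiff : Tendsto (fun n : ℕ => ψ (s / √n) (M n ω)
      - Complex.exp (-(M n ω * (((s / √n : ℝ) : ℂ) ^ 2 * v / 2)))) atTop (𝓝 0) :=
    squeeze_zero_norm' ((hθ.eventually hC).mono fun n hn => hn _) hbound
  simpa using hdiff.add hmain

/-- Fubini's theorem for an integer-valued random variable and an independent one. -/
lemma integral_indep_nat {Ω β : Type*} [MeasurableSpace Ω] [MeasurableSpace β] {Pr : Measure Ω}
    [IsProbabilityMeasure Pr] (M : Ω → ℕ) (hM : Measurable M) (Y : Ω → β) (hY : Measurable Y)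
    (hMY : IndepFun M Y Pr) (Φ : ℕ → β → ℂ) (hΦ : ∀ m, Measurable (Φ m))
    (hΦ1 : ∀ m y, ‖Φ m y‖ ≤ 1) :
    ∫ ω, Φ (M ω) (Y ω) ∂Pr = ∫ ω, ∫ ω', Φ (M ω) (Y ω') ∂Pr ∂Pr := by
  have hm : Measurable (fun z : ℕ × β => Φ z.1 z.2) := measurable_from_prod_countable_right hΦ
  have : IsProbabilityMeasure (Pr.map M) := Measure.isProbabilityMeasure_map hM.aemeasurable
  have : IsProbabilityMeasure (Pr.map Y) := Measure.isProbabilityMeasure_map hY.aemeasurable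
  have h1 := integral_map (μ := Pr) (hM.prodMk hY).aemeasurable
    (f := fun z : ℕ × β => Φ z.1 z.2) hm.aestronglyMeasurable
  rw [← h1, (indepFun_iff_map_prod_eq_prod_map_map hM.aemeasurable hY.aemeasurable).1 hMY,
    integral_prod _ (Integrable.of_bound hm.aestronglyMeasurable 1
      (Eventually.of_forall fun z => hΦ1 _ _)),
    integral_map hM.aemeasurable Measurable.of_discrete.aestronglyMeasurable]
  refine integral_congr_ae (Eventually.of_forall fun ω => ?_)
  exact integral_map hY.aemeasurable (hΦ _).aestronglyMeasurable

/-- Central limit theorem for a function of a finite Markov chain summed up to an independent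
random horizon that grows linearly, with a deterministic offset. -/
theorem tendsto_integral_markov_sum_random_horizon {E : Type*} [Fintype E] [MeasurableSpace E]
    [DiscreteMeasurableSpace E] {Ω : Type*} [MeasurableSpace Ω] {Pr : Measure Ω}
    [IsProbabilityMeasure Pr]
    (P : Matrix E E ℝ) (hPnn : ∀ x y, 0 ≤ P x y) (hPsum : ∀ x, ∑ y, P x y = 1)
    (X : ℕ → Ω → E) (hXmeas : ∀ k, Measurable (X k))
    (hXmarkov : ∀ k : ℕ, 1 ≤ k → ∀ f : ℕ → E,
      Pr (⋂ j ∈ Set.Icc 1 (k + 1), {ω | X j ω = f j})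
        = Pr (⋂ j ∈ Set.Icc 1 k, {ω | X j ω = f j}) * ENNReal.ofReal (P (f k) (f (k + 1))))
    (b g k : E → ℝ) (v : ℝ) (hv : 0 ≤ v) (hg : ∀ x, ∑ y, P x y * (b y + g y) = g x)
    (hk : ∀ x, ∑ y, P x y * (k y - b y ^ 2 / 2 - b y * g y) = k x - v / 2)
    (M : ℕ → Ω → ℕ) (hM : ∀ n, Measurable (M n)) (τ : ℝ) (hτ : 0 ≤ τ)
    (hMlim : ∀ᵐ ω ∂Pr, Tendsto (fun n : ℕ => (M n ω : ℝ) / n) atTop (𝓝 τ))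
    (hMX : ∀ n, IndepFun (M n) (fun ω (j : ℕ) => X j ω) Pr)
    (s₀ : ℝ) (F : BoundedContinuousFunction ℝ ℝ) :
    Tendsto (fun n : ℕ => ∫ ω, F ((s₀ + ∑ j ∈ Finset.Icc 1 (M n ω), b (X j ω)) / √n) ∂Pr)
      atTop (𝓝 (∫ x, F x ∂(gaussianReal 0 (Real.toNNReal (v * τ))))) := by
  have hXall : Measurable (fun ω (j : ℕ) => X j ω) := by fun_prop
  have hsum : ∀ m : ℕ, Measurable (fun x : ℕ → E => ∑ j ∈ Finset.Icc 1 m, b (x j)) := fun m =>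
    Finset.measurable_fun_sum _ fun j _ =>
      (Measurable.of_discrete (f := b)).comp (measurable_pi_apply j)
  have hT : ∀ n : ℕ, Measurable
      (fun ω => (s₀ + ∑ j ∈ Finset.Icc 1 (M n ω), b (X j ω)) / √(n : ℝ)) := by
    intro n
    have h1 : Measurable (fun z : ℕ × (ℕ → E) => ∑ j ∈ Finset.Icc 1 z.1, b (z.2 j)) :=
      measurable_from_prod_countable_right hsum
    exact ((h1.comp ((hM n).prodMk hXall)).const_add s₀).div_const _
  obtain ⟨C, hC⟩ :=
    exists_norm_charFun_sum_sub_le P hPnn hPsum X hXmeas hXmarkov b g k v hv hg hk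
  let law : ℕ → ProbabilityMeasure ℝ := fun n =>
    ⟨Pr.map _, Measure.isProbabilityMeasure_map (hT n).aemeasurable⟩
  have key : Tendsto law atTop
      (𝓝 (⟨gaussianReal 0 (Real.toNNReal (v * τ)), inferInstance⟩ : ProbabilityMeasure ℝ)) := by
    refine ProbabilityMeasure.tendsto_of_tendsto_charFun fun s => ?_
    have hψ := tendsto_integral_random_horizon (Pr := Pr)
      (fun θ m => ∫ ω, Complex.exp (θ * (∑ j ∈ Finset.Icc 1 m, b (X j ω) : ℝ) * Complex.I) ∂Pr)
      (fun θ m => by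
        refine (norm_integral_le_of_norm_le_const (C := 1)
          (Eventually.of_forall fun ω => ?_)).trans (by simp)
        rw [← Complex.ofReal_mul, Complex.norm_exp_ofReal_mul_I]) C v hC M hM τ hMlim s
    have hoff : Tendsto (fun n : ℕ => Complex.exp ((s * (s₀ / √n) : ℝ) * Complex.I)) atTop
        (𝓝 1) := by
      have h1 : Tendsto (fun n : ℕ => s * (s₀ / √(n : ℝ))) atTop (𝓝 0) := by
        simpa using ((Real.tendsto_sqrt_atTop.comp
          tendsto_natCast_atTop_atTop).const_div_atTop s₀).const_mul s
      have h2 : Continuous fun x : ℝ => Complex.exp (x * Complex.I) := by fun_prop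
      simpa [Function.comp_def] using (h2.tendsto 0).comp h1
    have hlim := hoff.mul hψ
    rw [one_mul] at hlim
    have hgauss : charFun (gaussianReal 0 (Real.toNNReal (v * τ))) s
        = Complex.exp (-(v * τ * s ^ 2 / 2)) := by
      have hc : ((Real.toNNReal (v * τ) : ℝ) : ℂ) = v * τ := by
        rw [Real.coe_toNNReal _ (mul_nonneg hv hτ)]; push_cast; rfl
      rw [charFun_gaussianReal, hc]
      simp
    simp only [ProbabilityMeasure.coe_mk, law, hgauss]
    refine hlim.congr fun n => ?_
    rw [charFun_apply_real, integral_map (hT n).aemeasurable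
        (Continuous.aestronglyMeasurable (by fun_prop)),
      ← integral_indep_nat (M n) (hM n) _ hXall (hMX n)
        (fun m x => Complex.exp ((s / √n : ℝ) * (∑ j ∈ Finset.Icc 1 m, b (x j) : ℝ) * Complex.I))
        (fun m => by have := hsum m; fun_prop)
        (fun m x => by rw [← Complex.ofReal_mul, Complex.norm_exp_ofReal_mul_I]),
      ← integral_const_mul]
    refine integral_congr_ae (Eventually.of_forall fun ω => ?_)
    simp only [← Complex.exp_add]
    push_cast
    ring_nf
  have := ProbabilityMeasure.tendsto_iff_forall_integral_tendsto.1 key F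
  simp only [ProbabilityMeasure.coe_mk, law] at this
  refine this.congr fun n => ?_
  exact integral_map (hT n).aemeasurable F.continuous.aestronglyMeasurable

/-- Diffusion limit for the compound Hawkes process with dependent orders and
fixed tick size (Corollary "Diffusion Limit for CHPDO"): for every `t > 0`,
`(S_{nt} - N_{nt} a*)/√n` converges in distribution to a centered Gaussian with
variance `σ² c t`, where `a* = δ(2π* - 1)` and
`σ² = 4δ²((1 - p' + π*(p' - p))/(p + p' - 2)² - π*(1 - π*))`.
The two-point state space `{δ, -δ}` is encoded by `Fin 2`, state `0`
corresponding to the value `δ` and state `1` to the value `-δ`. -/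
theorem diffusion_limit_CHPDO
    {Ω : Type*} [MeasurableSpace Ω] (Pr : Measure Ω) [IsProbabilityMeasure Pr]
    (δ : ℝ) (hδ : 0 < δ)
    (p p' : ℝ) (hp : 0 < p) (hp1 : p < 1) (hp' : 0 < p') (hp'1 : p' < 1)
    (P : Matrix (Fin 2) (Fin 2) ℝ) (hP : P = !![p, 1 - p; 1 - p', p'])
    (π : ℝ) (hπpos : 0 < π) (hπlt : π < 1)
    (hπstat : π * p + (1 - π) * (1 - p') = π)
    (X : ℕ → Ω → Fin 2)
    (hXmeas : ∀ k, Measurable (X k))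
    (hXmarkov : ∀ k : ℕ, 1 ≤ k → ∀ f : ℕ → Fin 2,
      Pr (⋂ j ∈ Set.Icc 1 (k + 1), {ω | X j ω = f j})
        = Pr (⋂ j ∈ Set.Icc 1 k, {ω | X j ω = f j}) * ENNReal.ofReal (P (f k) (f (k + 1))))
    (a : Fin 2 → ℝ) (ha : a = ![δ, -δ])
    (astar : ℝ) (hastar : astar = δ * (2 * π - 1))
    (σ2 : ℝ)
    (hσ2 : σ2 = 4 * δ ^ 2 * ((1 - p' + π * (p' - p)) / (p + p' - 2) ^ 2
        - π * (1 - π)))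
    (N : ℝ → Ω → ℕ)
    (hNmeas : ∀ t, Measurable (N t))
    (hN0 : ∀ ω, N 0 ω = 0)
    (hNmono : ∀ ω, Monotone (fun t => N t ω))
    (hNrc : ∀ ω t, ContinuousWithinAt (fun s => (N s ω : ℝ)) (Set.Ici t) t)
    (c : ℝ) (hc : 0 < c)
    (hNLLN : ∀ᵐ ω ∂Pr, Tendsto (fun t : ℝ => (N t ω : ℝ) / t) atTop (𝓝 c))
    (hindep : IndepFun (fun ω (t : ℝ) => N t ω) (fun ω (k : ℕ) => X k ω) Pr)
    (S0 : ℝ) (S : ℝ → Ω → ℝ)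
    (hS : ∀ t ω, S t ω = S0 + ∑ k ∈ Finset.Icc 1 (N t ω), a (X k ω))
    (t : ℝ) (ht : 0 < t) :
    ∀ F : BoundedContinuousFunction ℝ ℝ,
      Tendsto (fun n : ℕ =>
          ∫ ω, F ((S (n * t) ω - (N (n * t) ω : ℝ) * astar) / Real.sqrt n) ∂Pr)
        atTop
        (𝓝 (∫ x, F x ∂(gaussianReal 0 (Real.toNNReal (σ2 * c * t))))) := by
  intro F
  obtain ⟨d, hd⟩ : ∃ d, d = 2 - p - p' := ⟨_, rfl⟩
  have hd0 : 0 < d := by linarith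
  have hd2 : d < 2 := by linarith
  obtain rfl : p' = 1 - π * d := by rw [hd]; linarith
  obtain rfl : p = 1 - (1 - π) * d := by linarith
  have hσ2' : σ2 = 4 * δ ^ 2 * (π * (1 - π) * (2 - d) / d) := by
    rw [hσ2, show 1 - (1 - π) * d + (1 - π * d) - 2 = -d by ring]
    field_simp
    ring
  have h2d : 0 < 2 - d := by linarith
  have h1π : 0 < 1 - π := by linarith
  have hσ2nn : 0 ≤ σ2 := by rw [hσ2']; positivity
  have hM : ∀ᵐ ω ∂Pr, Tendsto (fun n : ℕ => (N (n * t) ω : ℝ) / n) atTop (𝓝 (c * t)) := by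
    filter_upwards [hNLLN] with ω hω
    have h1 : Tendsto (fun n : ℕ => (n : ℝ) * t) atTop atTop :=
      tendsto_natCast_atTop_atTop.atTop_mul_const ht
    refine ((hω.comp h1).mul_const t).congr fun n => ?_
    simp only [Function.comp]
    rw [div_mul_eq_mul_div, mul_div_mul_right _ _ ht.ne']
  have main := tendsto_integral_markov_sum_random_horizon (Pr := Pr) P
    (by
      rw [hP]
      intro x y
      fin_cases x <;> fin_cases y <;> simp <;> linarith)
    (by
      rw [hP]
      intro x
      fin_cases x <;> simp [Fin.sum_univ_two])
    X hXmeas hXmarkov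
    ![2 * δ * (1 - π), -(2 * δ * π)]
    ![(1 - d) / d * (2 * δ * (1 - π)), -((1 - d) / d * (2 * δ * π))]
    ![-(2 - d) / (2 * d ^ 2) * (4 * δ ^ 2) * (1 - 2 * π) * (1 - d) * (1 - π),
      (2 - d) / (2 * d ^ 2) * (4 * δ ^ 2) * (1 - 2 * π) * (1 - d) * π]
    σ2 hσ2nn
    (by
      rw [hP]
      intro x
      fin_cases x <;> simp [Fin.sum_univ_two] <;> field_simp <;> ring)
    (by
      rw [hP, hσ2']
      intro x
      fin_cases x <;> simp [Fin.sum_univ_two] <;> field_simp <;> ring)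
    (fun n ω => N (n * t) ω) (fun n => hNmeas _) (c * t) (by positivity) hM
    (fun n => hindep.comp (measurable_pi_apply (n * t)) measurable_id) S0 F
  rw [← mul_assoc] at main
  have ha' : ∀ x, ![2 * δ * (1 - π), -(2 * δ * π)] x = a x - astar := by
    rw [ha, hastar]
    intro x
    fin_cases x <;> simp <;> ring
  refine main.congr fun n => ?_
  refine integral_congr_ae (Eventually.of_forall fun ω => ?_)
  simp only [ha', hS, Finset.sum_sub_distrib, Finset.sum_const, Nat.card_Icc, nsmul_eq_mul,
    Nat.add_sub_cancel, add_sub_assoc]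
end
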